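/- Let α be a nonzero algebraic integer in ℚ̄. Then α is a d-number if and only if α² is a d-number. (Corollary 2.12.) -/

import Mathlib

/-- `ℚ̄`, a fixed algebraic closure of `ℚ`. -/
abbrev Qbar : Type := AlgebraicClosure ℚ

/-- The principal ideal `α𝔸` of the ring of algebraic integers, viewed as a subset of `ℚ̄`. -/
def principalSet (α : Qbar) : Set Qbar :=
  {x | ∃ β : Qbar, IsIntegral ℤ β ∧ x = α * β}

/-- `α` is a d-number: every field automorphism of `ℚ̄` maps the ideal `α𝔸` onto itself. -/
def IsDNumber (α : Qbar) : Prop :=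
  ∀ g : Qbar ≃+* Qbar, g '' principalSet α = principalSet α

theorem isIntegral_int_map_ringEquiv (g : Qbar ≃+* Qbar) {x : Qbar} (hx : IsIntegral ℤ x) :
    IsIntegral ℤ (g x) :=
  hx.map (g : Qbar →+* Qbar).toIntAlgHom

theorem image_principalSet_subset (g : Qbar ≃+* Qbar) {α : Qbar} (hα : α ≠ 0)
    (h : IsIntegral ℤ (g α / α)) : g '' principalSet α ⊆ principalSet α := by
  rintro _ ⟨_, ⟨β, hβ, rfl⟩, rfl⟩
  refine ⟨g α / α * g β, h.mul (isIntegral_int_map_ringEquiv g hβ), ?_⟩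
  rw [map_mul]
  field_simp

theorem isDNumber_iff_isIntegral_div {α : Qbar} (hα : α ≠ 0) :
    IsDNumber α ↔ ∀ g : Qbar ≃+* Qbar, IsIntegral ℤ (g α / α) := by
  refine ⟨fun h g => ?_, fun h g => ?_⟩
  · have hmem : g α ∈ principalSet α := by
      rw [← h g]
      exact ⟨α, ⟨1, isIntegral_one, (mul_one α).symm⟩, rfl⟩
    obtain ⟨β, hβ, hg⟩ := hmem
    rwa [hg, mul_div_cancel_left₀ β hα]
  · refine (image_principalSet_subset g hα (h g)).antisymm fun x hx => ?_
    exact ⟨g.symm x, image_principalSet_subset g.symm hα (h g.symm) ⟨x, hx, rfl⟩,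
      g.apply_symm_apply x⟩

/-- Corollary 2.12: a nonzero algebraic integer `α` is a d-number iff `α²` is. -/
theorem dNumber_iff_sq_dNumber (α : Qbar) (hα : α ≠ 0) (hint : IsIntegral ℤ α) :
    IsDNumber α ↔ IsDNumber (α ^ 2) := by
  rw [isDNumber_iff_isIntegral_div hα, isDNumber_iff_isIntegral_div (pow_ne_zero 2 hα)]
  refine forall_congr' fun g => ?_
  rw [map_pow, ← div_pow]
  exact ⟨fun h => h.pow 2, fun h => h.of_pow two_pos⟩
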